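/- Let f be a proper log-concave function on ℝ^d, s > 0, and let (A_s⊕α_s, a_s) represent the John s-ellipsoid of f. Then α_s^s ≥ e^{−d} ‖f‖; equivalently, the supremum of the John s-function of f satisfies ‖J_s f‖ ≥ e^{−d} ‖f‖, where ‖f‖ denotes the supremum of f. -/

import Mathlib

open MeasureTheory
open scoped BigOperators RealInnerProductSpace

noncomputable section

/-- `ℝ^d` with the Euclidean structure. -/
abbrev Ed (d : ℕ) := EuclideanSpace ℝ (Fin d)

/-- `f : ℝ^d → [0,∞)` is log-concave, i.e. `f = e^{-ψ}` for some convex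
`ψ : ℝ^d → ℝ ∪ {∞}`; equivalently, `f ≥ 0` and
`f(tx+(1-t)y) ≥ f(x)^t f(y)^{1-t}`. -/
def IsLogConcave {d : ℕ} (f : Ed d → ℝ) : Prop :=
  (∀ x, 0 ≤ f x) ∧
    ∀ x y : Ed d, ∀ t : ℝ, 0 ≤ t → t ≤ 1 →
      f x ^ t * f y ^ (1 - t) ≤ f (t • x + (1 - t) • y)

/-- A proper log-concave function: log-concave, upper semicontinuous,
with positive finite integral. -/
def ProperLogConcave {d : ℕ} (f : Ed d → ℝ) : Prop :=
  IsLogConcave f ∧ UpperSemicontinuous f ∧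
    0 < ∫⁻ x, ENNReal.ofReal (f x) ∧ (∫⁻ x, ENNReal.ofReal (f x)) < ⊤

/-- The `s`-lifting of `f`, a subset of `ℝ^d × ℝ = ℝ^{d+1}`. -/
def sLift {d : ℕ} (s : ℝ) (f : Ed d → ℝ) : Set (Ed d × ℝ) :=
  {p | |p.2| ≤ f p.1 ^ (1 / s)}

/-- The `d`-symmetric ellipsoid `(A⊕α)B^{d+1} + a` in `ℝ^{d+1} = ℝ^d × ℝ`. -/
def ellE {d : ℕ} (A : Matrix (Fin d) (Fin d) ℝ) (α : ℝ) (a : Ed d) : Set (Ed d × ℝ) :=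
  {p | ∃ y : Ed d, ∃ t : ℝ, ‖y‖ ^ 2 + t ^ 2 ≤ 1 ∧
        p.1 = Matrix.toEuclideanLin A y + a ∧ p.2 = α * t}

/-- The closed Euclidean unit ball `B^{d+1}` of `ℝ^{d+1} = ℝ^d × ℝ`. -/
def unitBallE (d : ℕ) : Set (Ed d × ℝ) := {p | ‖p.1‖ ^ 2 + p.2 ^ 2 ≤ 1}

/-- `κ_s = ∫_{B^d} (1-|x|²)^{s/2} dx`. -/
def kappa (d : ℕ) (s : ℝ) : ℝ :=
  ∫ x in Metric.closedBall (0 : Ed d) 1, (1 - ‖x‖ ^ 2) ^ (s / 2)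

/-- The `s`-volume of the ellipsoid represented by `(A⊕α, a)`:
`μ_s = κ_s α^s det A`. -/
def svol {d : ℕ} (s : ℝ) (A : Matrix (Fin d) (Fin d) ℝ) (α : ℝ) : ℝ :=
  kappa d s * α ^ s * A.det

/-- `(A, α, a)` represents the John `s`-ellipsoid of `f`: it is a d-symmetric
ellipsoid contained in the `s`-lifting of `f` of maximal `s`-volume. -/
def IsJohn {d : ℕ} (s : ℝ) (f : Ed d → ℝ)
    (A : Matrix (Fin d) (Fin d) ℝ) (α : ℝ) (a : Ed d) : Prop :=
  A.PosDef ∧ 0 < α ∧ ellE A α a ⊆ sLift s f ∧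
    ∀ (A' : Matrix (Fin d) (Fin d) ℝ) (α' : ℝ) (a' : Ed d),
      A'.PosDef → 0 < α' → ellE A' α' a' ⊆ sLift s f → svol s A' α' ≤ svol s A α

/-- The height function of the ellipsoid represented by `(A⊕α, a)`. -/
def heightFn {d : ℕ} (A : Matrix (Fin d) (Fin d) ℝ) (α : ℝ) (a : Ed d) (x : Ed d) : ℝ :=
  if ‖Matrix.toEuclideanLin A⁻¹ (x - a)‖ ≤ 1 then
    α * Real.sqrt (1 - ‖Matrix.toEuclideanLin A⁻¹ (x - a)‖ ^ 2)
  else 0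

/-- A point of `ℝ^d × ℝ` as a vector in `ℝ^{d+1}`. -/
def augVec {d : ℕ} (p : Ed d × ℝ) : Fin (d + 1) → ℝ :=
  Fin.snoc (fun i => p.1 i) p.2

/-- The block-diagonal matrix `A ⊕ α`. -/
def matAug {d : ℕ} (A : Matrix (Fin d) (Fin d) ℝ) (α : ℝ) :
    Matrix (Fin (d + 1)) (Fin (d + 1)) ℝ :=
  Matrix.of fun i j =>
    Fin.lastCases (Fin.lastCases α (fun _ => 0) j)
      (fun i' => Fin.lastCases 0 (fun j' => A i' j') j) i

/-- The Frobenius norm of a real matrix. -/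
def frobNorm {n : ℕ} (M : Matrix (Fin n) (Fin n) ℝ) : ℝ :=
  Real.sqrt (∑ i, ∑ j, M i j ^ 2)

/-- Asplund sum (sup-convolution) of two functions. -/
def asplund {d : ℕ} (f g : Ed d → ℝ) : Ed d → ℝ :=
  fun x => ⨆ y : Ed d, f y * g (x - y)

/-- Epi-product `(λ ∗ f)(x) = f(x/λ)^λ`. -/
def epiProd {d : ℕ} (l : ℝ) (f : Ed d → ℝ) : Ed d → ℝ :=
  fun x => f (l⁻¹ • x) ^ l

/-- The flat ellipsoid function `α · χ_{A B^d + a}`. -/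
def flatFn {d : ℕ} (A : Matrix (Fin d) (Fin d) ℝ) (α : ℝ) (a : Ed d) (x : Ed d) : ℝ :=
  if ‖Matrix.toEuclideanLin A⁻¹ (x - a)‖ ≤ 1 then α else 0

/-- The Gaussian density `G[(A⊕α, a)](x) = α e^{−|A^{-1}(x−a)|²}`. -/
def gaussFn {d : ℕ} (A : Matrix (Fin d) (Fin d) ℝ) (α : ℝ) (a : Ed d) (x : Ed d) : ℝ :=
  α * Real.exp (-‖Matrix.toEuclideanLin A⁻¹ (x - a)‖ ^ 2)

/-- Operator (`ℓ₂ → ℓ₂`) norm of a matrix. -/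
def opNorm {d : ℕ} (M : Matrix (Fin d) (Fin d) ℝ) : ℝ :=
  ‖Matrix.toEuclideanCLM (𝕜 := ℝ) M‖

theorem kappa_pos (d : ℕ) {s : ℝ} (hs : 0 < s) : 0 < kappa d s := by
  unfold kappa
  have hc : Continuous fun x : Ed d => (1 - ‖x‖ ^ 2) ^ (s / 2) :=
    (by fun_prop : Continuous fun x : Ed d => 1 - ‖x‖ ^ 2).rpow_const
      fun _ => Or.inr (by positivity)
  have hnn : ∀ x ∈ Metric.closedBall (0 : Ed d) 1, 0 ≤ (1 - ‖x‖ ^ 2) ^ (s / 2) := fun x hx => by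
    have hx' : ‖x‖ ≤ 1 := by simpa using hx
    exact Real.rpow_nonneg (by nlinarith [norm_nonneg x]) _
  rw [setIntegral_pos_iff_support_of_nonneg_ae
    ((ae_restrict_iff' measurableSet_closedBall).2 (ae_of_all _ hnn))
    (hc.continuousOn.integrableOn_compact (isCompact_closedBall _ _))]
  refine (Metric.measure_ball_pos volume (0 : Ed d) one_pos).trans_le (measure_mono fun x hx => ?_)
  have hx' : ‖x‖ < 1 := by simpa using hx
  exact ⟨(Real.rpow_pos_of_pos (by nlinarith [norm_nonneg x]) _).ne',
    Metric.ball_subset_closedBall hx⟩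

/-- If `f` is log-concave, then so is `f ^ (1 / s)`. -/
theorem IsLogConcave.rpow_one_div {d : ℕ} {f : Ed d → ℝ} (hf : IsLogConcave f) {s : ℝ}
    (hs : 0 < s) : IsLogConcave fun x => f x ^ (1 / s) := by
  refine ⟨fun x => Real.rpow_nonneg (hf.1 x) _, fun x y t ht0 ht1 => ?_⟩
  have hx := hf.1 x
  have hy := hf.1 y
  calc (f x ^ (1 / s)) ^ t * (f y ^ (1 / s)) ^ (1 - t)
      = (f x ^ t * f y ^ (1 - t)) ^ (1 / s) := by
        rw [Real.mul_rpow (by positivity) (by positivity), ← Real.rpow_mul hx, ← Real.rpow_mul hy,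
          ← Real.rpow_mul hx, ← Real.rpow_mul hy, mul_comm t, mul_comm (1 - t)]
    _ ≤ _ := Real.rpow_le_rpow (by positivity) (hf.2 x y t ht0 ht1) (by positivity)

/-- Contracting an ellipsoid in the `s`-lifting of a log-concave function towards a point `x₀`,
while interpolating the heights geometrically, keeps it inside the `s`-lifting. -/
theorem ellE_contract_subset_sLift {d : ℕ} {s : ℝ} (hs : 0 < s) {f : Ed d → ℝ}
    (hf : IsLogConcave f) {A : Matrix (Fin d) (Fin d) ℝ} {α : ℝ} {a : Ed d} (hα : 0 < α)
    (hE : ellE A α a ⊆ sLift s f) (x₀ : Ed d) {r : ℝ} (hr0 : 0 ≤ r) (hr1 : r ≤ 1) :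
    ellE (r • A) (α ^ r * (f x₀ ^ (1 / s)) ^ (1 - r)) (r • a + (1 - r) • x₀) ⊆ sLift s f := by
  rintro ⟨p, q⟩ ⟨y, t, hyt, rfl, rfl⟩
  have hg := hf.rpow_one_div hs
  have hmem : |α * t| ≤ f (Matrix.toEuclideanLin A y + a) ^ (1 / s) :=
    hE (a := (Matrix.toEuclideanLin A y + a, α * t)) ⟨y, t, hyt, rfl, rfl⟩
  have ht : |t| ≤ 1 := abs_le_one_iff_mul_self_le_one.2 (by nlinarith [sq_nonneg ‖y‖])
  have hx₀ : 0 ≤ (f x₀ ^ (1 / s)) ^ (1 - r) := Real.rpow_nonneg (hg.1 x₀) _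
  have hαr : 0 ≤ α ^ r := by positivity
  have htr : |t| ≤ |t| ^ r := by
    rcases (abs_nonneg t).eq_or_lt with h | h
    · rw [← h]; exact Real.rpow_nonneg le_rfl _
    · simpa using Real.rpow_le_rpow_of_exponent_ge h ht hr1
  have hpt : Matrix.toEuclideanLin (r • A) y + (r • a + (1 - r) • x₀)
      = r • (Matrix.toEuclideanLin A y + a) + (1 - r) • x₀ := by
    rw [map_smul, LinearMap.smul_apply, smul_add, add_assoc]
  change |α ^ r * (f x₀ ^ (1 / s)) ^ (1 - r) * t| ≤ f (_ + _) ^ (1 / s)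
  rw [hpt]
  calc |α ^ r * (f x₀ ^ (1 / s)) ^ (1 - r) * t|
      = α ^ r * |t| * (f x₀ ^ (1 / s)) ^ (1 - r) := by
        rw [abs_mul, abs_of_nonneg (mul_nonneg hαr hx₀)]; ring
    _ ≤ α ^ r * |t| ^ r * (f x₀ ^ (1 / s)) ^ (1 - r) := by gcongr
    _ = |α * t| ^ r * (f x₀ ^ (1 / s)) ^ (1 - r) := by
        rw [abs_mul, abs_of_pos hα, Real.mul_rpow hα.le (abs_nonneg t)]
    _ ≤ (f (Matrix.toEuclideanLin A y + a) ^ (1 / s)) ^ r * (f x₀ ^ (1 / s)) ^ (1 - r) := by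
        gcongr
    _ ≤ _ := hg.2 _ _ r hr0 hr1

/-- The John `s`-ellipsoid beats every contraction of itself towards a point `x₀`. -/
theorem IsJohn.mul_log_le {d : ℕ} {s : ℝ} (hs : 0 < s) {f : Ed d → ℝ} (hf : IsLogConcave f)
    {A : Matrix (Fin d) (Fin d) ℝ} {α : ℝ} {a : Ed d} (hJ : IsJohn s f A α a) {x₀ : Ed d}
    (hx₀ : 0 < f x₀) {r : ℝ} (hr0 : 0 < r) (hr1 : r ≤ 1) :
    (1 - r) * (Real.log (f x₀) - Real.log (α ^ s)) ≤ -(d * Real.log r) := by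
  obtain ⟨hA, hα, hE, hmax⟩ := hJ
  have hvol := hmax (r • A) (α ^ r * (f x₀ ^ (1 / s)) ^ (1 - r)) (r • a + (1 - r) • x₀)
    (hA.smul hr0) (by positivity) (ellE_contract_subset_sLift hs hf hα hE x₀ hr0.le hr1)
  have hκ := kappa_pos d hs
  have hdet := hA.det_pos
  simp only [svol, Matrix.det_smul, Fintype.card_fin] at hvol
  have hlog := Real.log_le_log (by positivity) hvol
  rw [Real.log_mul (by positivity) (by positivity), Real.log_mul (by positivity) (by positivity),
    Real.log_mul (by positivity) (by positivity), Real.log_mul (by positivity) (by positivity),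
    Real.log_mul (by positivity) (by positivity), Real.log_rpow (by positivity),
    Real.log_mul (by positivity) (by positivity), Real.log_rpow hα, Real.log_rpow hα,
    Real.log_rpow (by positivity), Real.log_rpow hx₀, Real.log_pow] at hlog
  have hcancel : s * ((1 - r) * (1 / s * Real.log (f x₀))) = (1 - r) * Real.log (f x₀) := by
    field_simp
  rw [Real.log_rpow hα]
  linarith

/-- **Lower bound on the height of the John `s`-ellipsoid.** -/
theorem john_sellipsoid_height_bound (d : ℕ) (hd : 1 ≤ d) (s : ℝ) (hs : 0 < s)
    (f : Ed d → ℝ) (hf : ProperLogConcave f)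
    (A : Matrix (Fin d) (Fin d) ℝ) (α : ℝ) (a : Ed d)
    (hJ : IsJohn s f A α a) :
    Real.exp (-(d : ℝ)) * (⨆ x, f x) ≤ α ^ s := by
  have hα : 0 < α := hJ.2.1
  have hαs : 0 < α ^ s := Real.rpow_pos_of_pos hα s
  suffices h : ∀ x, f x ≤ Real.exp d * α ^ s by
    rw [Real.exp_neg, inv_mul_le_iff₀ (Real.exp_pos _)]
    exact ciSup_le h
  intro x
  rcases (hf.1.1 x).eq_or_lt with hx | hx
  · rw [← hx]; positivity
  have hd0 : (0 : ℝ) < d := by exact_mod_cast hd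
  suffices hL : Real.log (f x) - Real.log (α ^ s) ≤ d by
    rw [← Real.log_le_log_iff hx (by positivity), Real.log_mul (by positivity) hαs.ne',
      Real.log_exp]
    linarith
  set L := Real.log (f x) - Real.log (α ^ s)
  by_contra! hL
  have hL0 : 0 < L := hd0.trans hL
  -- The contraction factor `r` lies strictly between `d / L` and `1`.
  obtain ⟨r, hrL, hr1⟩ := exists_between ((div_lt_one hL0).2 hL)
  have hr0 : 0 < r := (by positivity : 0 < d / L).trans hrL
  have hle : (1 - r) * L ≤ -(d * Real.log r) := hJ.mul_log_le hs hf.1 hx hr0 hr1.le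
  have hlog : d * (1 - r⁻¹) ≤ d * Real.log r := by
    gcongr
    exact Real.one_sub_inv_le_log_of_pos hr0
  have hinv : r * (d * (1 - r⁻¹)) = d * (r - 1) := by field_simp
  have hmul : r * ((1 - r) * L) ≤ -(r * (d * (1 - r⁻¹))) := by
    rw [← mul_neg]
    exact mul_le_mul_of_nonneg_left (by linarith) hr0.le
  rw [div_lt_iff₀ hL0] at hrL
  nlinarith
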